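/- arXiv:1702.01309 — 9 statements merged into one kernel-verified Lean document; each statement's English description precedes it below -/
import Mathlib

section
/- Let 0 ≤ l ≤ m and 0 ≤ i ≤ N−1. Then the maximum of |L ∩ C_i^{(N)}| over all F_q-subspaces L ⊆ F_Q with dim_{F_q} L = l equals f(l), where f(l) = q^l − 1 for 0 ≤ l ≤ m/2 and f(l) = (q^l − 1)/N + (N−1)(q^{m/2} − q^{l−m/2})/N for m/2 ≤ l ≤ m. -/
open Module

/-- Submodules of every intermediate dimension exist between two nested subspaces. -/
theorem Submodule.exists_between_finrank_eq {K V : Type*} [Field K] [AddCommGroup V] [Module K V]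
    [FiniteDimensional K V] {A B : Submodule K V} (hAB : A ≤ B) {n : ℕ}
    (hA : finrank K A ≤ n) (hB : n ≤ finrank K B) :
    ∃ U : Submodule K V, A ≤ U ∧ U ≤ B ∧ finrank K U = n := by
  induction n, hA using Nat.le_induction with
  | base => exact ⟨A, le_rfl, hAB, rfl⟩
  | succ n hn ih =>
    obtain ⟨U, hAU, hUB, hU⟩ := ih (by omega)
    have hlt : U < B := lt_of_le_of_ne hUB (by rintro rfl; omega)
    obtain ⟨x, hxB, hxU⟩ := SetLike.exists_of_lt hlt
    refine ⟨U ⊔ K ∙ x, hAU.trans le_sup_left, sup_le hUB (by simpa using hxB), ?_⟩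
    have hx0 : x ≠ 0 := by rintro rfl; exact hxU U.zero_mem
    have hdis : U ⊓ K ∙ x = ⊥ :=
      disjoint_iff.1 ((Submodule.disjoint_span_singleton' hx0).2 hxU)
    have h := Submodule.finrank_sup_add_finrank_inf_eq U (K ∙ x)
    rw [hdis, finrank_bot, finrank_span_singleton hx0] at h
    omega

section Spread

variable {K F : Type*} [Field K] [Fintype K] [Field F] [Fintype F] [Algebra K F]

omit [Fintype K] [Fintype F] in
/-- Multiplication by a nonzero element preserves the dimension of subspaces. -/
theorem finrank_map_mulLeft {a : F} (ha : a ≠ 0) (L : Submodule K F) :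
    finrank K (L.map (LinearMap.mulLeft K a)) = finrank K L :=
  (Submodule.equivMapOfInjective _ (fun _ _ h => mul_left_cancel₀ ha h) L).finrank_eq.symm

omit [Fintype K] [Fintype F] in
theorem mem_map_mulLeft_inv {a : F} (ha : a ≠ 0) (L : Submodule K F) (x : F) :
    x ∈ L.map (LinearMap.mulLeft K a⁻¹) ↔ a * x ∈ L := by
  constructor
  · rintro ⟨y, hy, rfl⟩
    simpa [ha] using hy
  · intro h
    exact ⟨a * x, h, by simp [ha]⟩

variable {h : ℕ} (E : IntermediateField K F)

omit [Fintype K] in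
/-- In a space of dimension `2 * h`, a subspace meets each translate of a subfield of
dimension `h` in codimension at most `h`. -/
theorem le_finrank_inf_map_mulLeft (hE : finrank K E = h) (hF : finrank K F = 2 * h)
    (L : Submodule K F) {b : F} (hb : b ≠ 0) :
    finrank K L - h ≤
      finrank K ↥(E.toSubalgebra.toSubmodule ⊓ L.map (LinearMap.mulLeft K b⁻¹)) := by
  have h1 := Submodule.finrank_sup_add_finrank_inf_eq E.toSubalgebra.toSubmodule
    (L.map (LinearMap.mulLeft K b⁻¹))
  have h2 := Submodule.finrank_le (E.toSubalgebra.toSubmodule ⊔ L.map (LinearMap.mulLeft K b⁻¹))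
  have h3 : finrank K E.toSubalgebra.toSubmodule = h := hE
  rw [finrank_map_mulLeft (inv_ne_zero hb), h3] at h1
  omega

omit [Fintype K] in
/-- Equality holds when `L` contains another translate of the subfield. -/
theorem finrank_inf_map_mulLeft_eq (hE : finrank K E = h) (hF : finrank K F = 2 * h)
    (L : Submodule K F) {b w : F} (hb : b ≠ 0) (hw : w ≠ 0)
    (hwL : E.toSubalgebra.toSubmodule.map (LinearMap.mulLeft K w) ≤ L) (hbw : b⁻¹ * w ∉ E) :
    finrank K ↥(E.toSubalgebra.toSubmodule ⊓ L.map (LinearMap.mulLeft K b⁻¹)) =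
      finrank K L - h := by
  have h3 : finrank K E.toSubalgebra.toSubmodule = h := hE
  have h0 := finrank_map_mulLeft (inv_ne_zero hb) L
  set M := E.toSubalgebra.toSubmodule with hM
  set P := M.map (LinearMap.mulLeft K (b⁻¹ * w)) with hP
  have hPL : P ≤ L.map (LinearMap.mulLeft K b⁻¹) := by
    rintro _ ⟨e, he, rfl⟩
    exact ⟨w * e, hwL ⟨e, he, rfl⟩, by simp⟩
  have hinf : M ⊓ P = ⊥ := by
    rw [eq_bot_iff]
    rintro _ ⟨hx, e, he, rfl⟩
    by_contra hne
    have hx' : b⁻¹ * w * e ∈ E := hx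
    have he' : e ∈ E := he
    have he0 : e ≠ 0 := by rintro rfl; simp at hne
    refine hbw ?_
    have := E.mul_mem hx' (E.inv_mem he')
    rwa [mul_assoc, mul_inv_cancel₀ he0, mul_one] at this
  have hPr : finrank K P = h := by
    rw [hP, finrank_map_mulLeft (mul_ne_zero (inv_ne_zero hb) hw), h3]
  have h1 := Submodule.finrank_sup_add_finrank_inf_eq M P
  rw [hinf, finrank_bot, h3, hPr] at h1
  have h2 := Submodule.finrank_mono (sup_le_sup_left hPL M)
  have h4 := Submodule.finrank_le (M ⊔ L.map (LinearMap.mulLeft K b⁻¹))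
  have h5 := Submodule.finrank_sup_add_finrank_inf_eq M (L.map (LinearMap.mulLeft K b⁻¹))
  omega

omit [Fintype F] in
theorem ncard_submodule_ne_zero [Finite F] (M : Submodule K F) :
    {x : F | x ≠ 0 ∧ x ∈ M}.ncard = Fintype.card K ^ finrank K M - 1 := by
  have h1 : {x : F | x ≠ 0 ∧ x ∈ M} = (M : Set F) \ {0} := by
    ext x; simp [and_comm]
  rw [h1, Set.ncard_sdiff_singleton_of_mem M.zero_mem]
  congr 1
  have := Module.natCard_eq_pow_finrank (K := K) (V := M)
  rwa [Nat.card_eq_fintype_card (α := K)] at this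

open scoped Classical in
/-- Double counting of the pairs `(b, e)` with `b ∈ B`, `e` in the subfield and `b * e ∈ L`,
for a set `B` of nonzero elements stable under multiplication by the subfield. -/
theorem sum_card_inf_map_mulLeft (L : Submodule K F) (B : Finset F) (hB0 : ∀ b ∈ B, b ≠ 0)
    (hB : ∀ e ∈ E, e ≠ 0 → ∀ x, x * e ∈ B ↔ x ∈ B) :
    ∑ b ∈ B, (Fintype.card K ^ finrank K
      ↥(E.toSubalgebra.toSubmodule ⊓ L.map (LinearMap.mulLeft K b⁻¹)) - 1) =
      (Fintype.card K ^ finrank K E - 1) * (B.filter (· ∈ L)).card := by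
  set T : Finset F := Finset.univ.filter fun e => e ≠ 0 ∧ e ∈ E with hT
  have key := Finset.sum_card_bipartiteAbove_eq_sum_card_bipartiteBelow
    (s := B) (t := T) (fun b e => b * e ∈ L)
  have hTc : T.card = Fintype.card K ^ finrank K E - 1 := by
    have : {x : F | x ≠ 0 ∧ x ∈ E.toSubalgebra.toSubmodule}.ncard =
        Fintype.card K ^ finrank K E - 1 := ncard_submodule_ne_zero _
    rw [← Set.ncard_coe_finset]
    convert this using 2
    ext x; simp [hT]
  have hleft : ∀ b ∈ B, (T.bipartiteAbove (fun b e => b * e ∈ L) b).card =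
      Fintype.card K ^ finrank K
      ↥(E.toSubalgebra.toSubmodule ⊓ L.map (LinearMap.mulLeft K b⁻¹)) - 1 := by
    intro b hb
    rw [← ncard_submodule_ne_zero, ← Set.ncard_coe_finset]
    congr 1
    ext x
    simp only [Finset.coe_bipartiteAbove, Set.mem_ofPred_eq, Submodule.mem_inf,
      mem_map_mulLeft_inv (hB0 b hb), hT, Finset.mem_filter, Finset.mem_univ, true_and, and_assoc]
    rfl
  have hright : ∀ e ∈ T, (B.bipartiteBelow (fun b e => b * e ∈ L) e).card =
      (B.filter (· ∈ L)).card := by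
    intro e he
    obtain ⟨he0, heE⟩ : e ≠ 0 ∧ e ∈ E := by simpa [hT] using he
    refine Finset.card_bij (fun b _ => b * e) ?_ ?_ ?_
    · intro b hb
      simp only [Finset.mem_bipartiteBelow, Finset.mem_filter] at hb ⊢
      exact ⟨(hB e heE he0 b).2 hb.1, hb.2⟩
    · intro a _ b _ hab
      exact mul_right_cancel₀ he0 hab
    · intro b hb
      simp only [Finset.mem_filter] at hb
      refine ⟨b * e⁻¹, ?_, by simp [he0]⟩
      simp only [Finset.mem_bipartiteBelow]
      rw [← hB e heE he0, inv_mul_cancel_right₀ he0]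
      exact hb
  rw [Finset.sum_congr rfl hleft, Finset.sum_congr rfl hright, Finset.sum_const, hTc,
    smul_eq_mul] at key
  exact key

theorem ncard_add_ncard_compl_inter (L : Submodule K F) (C : Set F) (hC0 : ∀ x ∈ C, x ≠ 0) :
    ((L : Set F) ∩ C).ncard + {x : F | (x ≠ 0 ∧ x ∉ C) ∧ x ∈ L}.ncard + 1 =
      Fintype.card K ^ finrank K L := by
  have h1 : {x : F | x ≠ 0 ∧ x ∈ L} =
      ((L : Set F) ∩ C) ∪ {x : F | (x ≠ 0 ∧ x ∉ C) ∧ x ∈ L} := by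
    ext x
    have := hC0 x
    simp only [Set.mem_ofPred_eq, Set.mem_union, Set.mem_inter_iff, SetLike.mem_coe]
    tauto
  have h2 : Disjoint ((L : Set F) ∩ C) {x : F | (x ≠ 0 ∧ x ∉ C) ∧ x ∈ L} := by
    rw [Set.disjoint_left]
    rintro x ⟨-, hx⟩ ⟨⟨-, hx'⟩, -⟩
    exact hx' hx
  have h3 := ncard_submodule_ne_zero L
  rw [h1, Set.ncard_union_eq h2] at h3
  have : 0 < Fintype.card K ^ finrank K L := pow_pos Fintype.card_pos _
  omega

/-- The double count expressed for the complement of `C`. -/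
theorem sum_card_compl (L : Submodule K F) (C : Set F)
    (hC : ∀ e ∈ E, e ≠ 0 → ∀ x, x * e ∈ C ↔ x ∈ C) (B : Finset F)
    (hB : ∀ x, x ∈ B ↔ x ≠ 0 ∧ x ∉ C) :
    ∑ b ∈ B, (Fintype.card K ^ finrank K
      ↥(E.toSubalgebra.toSubmodule ⊓ L.map (LinearMap.mulLeft K b⁻¹)) - 1) =
      (Fintype.card K ^ finrank K E - 1) * {x : F | (x ≠ 0 ∧ x ∉ C) ∧ x ∈ L}.ncard := by
  classical
  rw [sum_card_inf_map_mulLeft E L B (fun b hb => ((hB b).1 hb).1) (fun e he he0 x => by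
    rw [hB, hB, hC e he he0]; simp [he0]), ← Set.ncard_coe_finset]
  congr 2
  ext x
  simp [hB]

/-- An upper bound for the intersection of a subspace with a union of translates of `E`,
stated for the complementary set. -/
theorem le_ncard_compl_inter (hE : finrank K E = h) (hF : finrank K F = 2 * h)
    (L : Submodule K F) (C : Set F) (hC : ∀ e ∈ E, e ≠ 0 → ∀ x, x * e ∈ C ↔ x ∈ C) :
    {x : F | x ≠ 0 ∧ x ∉ C}.ncard * (Fintype.card K ^ (finrank K L - h) - 1) ≤
      (Fintype.card K ^ h - 1) * {x : F | (x ≠ 0 ∧ x ∉ C) ∧ x ∈ L}.ncard := by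
  classical
  have hB : ∀ x, x ∈ Set.toFinset {x : F | x ≠ 0 ∧ x ∉ C} ↔ x ≠ 0 ∧ x ∉ C := by simp
  have h1 := sum_card_compl E L C hC _ hB
  rw [hE] at h1
  rw [← h1, Set.ncard_eq_toFinset_card', ← smul_eq_mul]
  refine Finset.card_nsmul_le_sum _ _ _ fun b hb => ?_
  exact Nat.sub_le_sub_right (Nat.pow_le_pow_right Fintype.card_pos
    (le_finrank_inf_map_mulLeft E hE hF L ((hB b).1 hb).1)) 1

/-- The bound `le_ncard_compl_inter` is attained by subspaces containing a translate of `E`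
inside `C`. -/
theorem ncard_compl_inter_eq (hE : finrank K E = h) (hF : finrank K F = 2 * h)
    (L : Submodule K F) (C : Set F) (hC : ∀ e ∈ E, e ≠ 0 → ∀ x, x * e ∈ C ↔ x ∈ C)
    {w : F} (hw : w ≠ 0) (hwC : w ∈ C)
    (hwL : E.toSubalgebra.toSubmodule.map (LinearMap.mulLeft K w) ≤ L) :
    {x : F | x ≠ 0 ∧ x ∉ C}.ncard * (Fintype.card K ^ (finrank K L - h) - 1) =
      (Fintype.card K ^ h - 1) * {x : F | (x ≠ 0 ∧ x ∉ C) ∧ x ∈ L}.ncard := by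
  classical
  have hB : ∀ x, x ∈ Set.toFinset {x : F | x ≠ 0 ∧ x ∉ C} ↔ x ≠ 0 ∧ x ∉ C := by simp
  have h1 := sum_card_compl E L C hC _ hB
  rw [hE] at h1
  rw [← h1, Set.ncard_eq_toFinset_card', ← smul_eq_mul]
  refine (Finset.sum_const _).symm.trans (Finset.sum_congr rfl fun b hb => ?_)
  obtain ⟨hb0, hbC⟩ := (hB b).1 hb
  rw [finrank_inf_map_mulLeft_eq E hE hF L hb0 hw hwL]
  intro hmem
  have hne : b⁻¹ * w ≠ 0 := mul_ne_zero (inv_ne_zero hb0) hw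
  refine hbC ((hC _ hmem hne b).1 ?_)
  rwa [mul_inv_cancel_left₀ hb0]

end Spread

/-- A finite field of even degree `2 * h` over `K` has an intermediate field of degree `h`. -/
theorem exists_intermediateField_finrank_eq_half {K F : Type*} [Field K] [Field F]
    [Finite F] [Algebra K F] {h : ℕ} (hF : finrank K F = 2 * h) :
    ∃ E : IntermediateField K F, finrank K E = h := by
  have : Fintype F := Fintype.ofFinite F
  have : Module.Finite K F := Module.Finite.of_finite
  have hcard : Nat.card Gal(F/K) = 2 * h := by rw [IsGalois.card_aut_eq_finrank, hF]
  have : Fact (Nat.Prime 2) := ⟨Nat.prime_two⟩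
  obtain ⟨H, hH⟩ := Sylow.exists_subgroup_card_pow_prime (G := Gal(F/K)) 2 (n := 1)
    (by rw [hcard]; simp)
  refine ⟨IntermediateField.fixedField H, ?_⟩
  have h1 := IntermediateField.finrank_fixedField_eq_card H
  have h2 := finrank_mul_finrank K (IntermediateField.fixedField H) F
  rw [h1, hH, hF] at h2
  omega

/-- In the semiprimitive case with odd quotient, `N` divides `√Q + 1`. -/
theorem dvd_pow_add_one_of_pow_eq_neg_one {p N j n : ℕ} (hj : (p : ZMod N) ^ j = -1)
    (hn : 2 * j ∣ 2 * n) (hodd : Odd (2 * n / (2 * j))) : N ∣ p ^ n + 1 := by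
  rcases Nat.eq_zero_or_pos j with rfl | hj0
  · simp at hodd
  have hn' : j ∣ n := Nat.dvd_of_mul_dvd_mul_left two_pos hn
  obtain ⟨k, rfl⟩ := hn'
  rw [← mul_assoc, Nat.mul_div_cancel_left _ (by omega)] at hodd
  rw [← ZMod.natCast_eq_zero_iff]
  push_cast
  rw [pow_mul, hj, hodd.neg_one_pow]
  ring

/-- A generator of the multiplicative group of a field with more than two elements
is nonzero of full order. -/
theorem orderOf_eq_card_sub_one {F : Type*} [Field F] [Fintype F] (h2 : 2 < Fintype.card F)
    {γ : F} (hγ : ∀ x : F, x ≠ 0 → ∃ k : ℕ, x = γ ^ k) :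
    γ ≠ 0 ∧ orderOf γ = Fintype.card F - 1 := by
  classical
  have hγ0 : γ ≠ 0 := by
    rintro rfl
    have : Fintype.card F ≤ ({0, 1} : Finset F).card := by
      refine Finset.card_le_card (s := Finset.univ) fun x _ => ?_
      by_cases hx : x = 0
      · simp [hx]
      · obtain ⟨k, rfl⟩ := hγ x hx
        rcases Nat.eq_zero_or_pos k with rfl | hk
        · simp
        · simp [hk.ne']
    have := Finset.card_le_two (a := (0 : F)) (b := 1)
    omega
  refine ⟨hγ0, ?_⟩
  have hu : orderOf (Units.mk0 γ hγ0) = Nat.card Fˣ := by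
    refine orderOf_eq_card_of_forall_mem_zpowers fun x => ?_
    obtain ⟨k, hk⟩ := hγ x x.ne_zero
    exact ⟨k, by ext; simp [hk]⟩
  rw [← orderOf_units, Units.val_mk0] at hu
  rw [hu, Nat.card_units, Nat.card_eq_fintype_card]

section Cyclotomy

variable {F : Type*} [Field F] [Fintype F] {γ : F} {N : ℕ} (i : ℕ)

/-- The number of elements of a cyclotomy class of order `N`. -/
theorem ncard_cyclotomyClass_mul (hγ0 : γ ≠ 0) (hord : orderOf γ = Fintype.card F - 1)
    (hN : N ∣ Fintype.card F - 1) (hN0 : N ≠ 0) :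
    {x : F | ∃ c : ℕ, x = γ ^ i * (γ ^ N) ^ c}.ncard * N = Fintype.card F - 1 := by
  set g : Fˣ := Units.mk0 γ hγ0 with hg
  have hgord : orderOf g = Fintype.card F - 1 := by rw [← hord, ← orderOf_units, hg, Units.val_mk0]
  have h1 : {x : F | ∃ c : ℕ, x = γ ^ i * (γ ^ N) ^ c} =
      (fun y : Fˣ => γ ^ i * (y : F)) '' (Submonoid.powers (g ^ N) : Set Fˣ) := by
    ext x
    constructor
    · rintro ⟨c, rfl⟩
      exact ⟨(g ^ N) ^ c, ⟨c, rfl⟩, by simp [hg]⟩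
    · rintro ⟨_, ⟨c, rfl⟩, rfl⟩
      exact ⟨c, by simp [hg]⟩
  have hinj : Function.Injective fun y : Fˣ => γ ^ i * (y : F) :=
    (mul_right_injective₀ (pow_ne_zero i hγ0)).comp Units.val_injective
  have h2 : Nat.card (Submonoid.powers (g ^ N)) = orderOf (g ^ N) := Nat.card_submonoidPowers
  rw [h1, Set.ncard_image_of_injective _ hinj, ← Nat.card_coe_set_eq, SetLike.coe_sort_coe, h2,
    orderOf_pow_of_dvd hN0 (by rwa [hgord]), hgord, Nat.div_mul_cancel hN]

omit [Fintype F] in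
/-- Elements of a subfield of order `r`, where `|F| = r ^ 2`, are `N`-th powers when `N ∣ r + 1`. -/
theorem exists_pow_eq_of_pow_eq_one {r : ℕ} (hγ : ∀ x : F, x ≠ 0 → ∃ k : ℕ, x = γ ^ k)
    (hord : orderOf γ = (r - 1) * (r + 1)) (hr : 1 < r) (hN : N ∣ r + 1) {e : F} (he0 : e ≠ 0)
    (he : e ^ (r - 1) = 1) : ∃ c : ℕ, e = (γ ^ N) ^ c := by
  obtain ⟨k, rfl⟩ := hγ e he0
  rw [← pow_mul] at he
  have h1 := orderOf_dvd_of_pow_eq_one he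
  rw [hord, mul_comm k] at h1
  obtain ⟨c, rfl⟩ := hN.trans (Nat.dvd_of_mul_dvd_mul_left (by omega) h1)
  exact ⟨c, pow_mul _ _ _⟩

end Cyclotomy

theorem mul_mem_iff_of_subfield_pow {F : Type*} [Field F] {g w : F} {E : Subfield F}
    (hE : ∀ e ∈ E, e ≠ 0 → ∃ c : ℕ, e = g ^ c) :
    ∀ e ∈ E, e ≠ 0 → ∀ x, x * e ∈ {x : F | ∃ c : ℕ, x = w * g ^ c} ↔
      x ∈ {x : F | ∃ c : ℕ, x = w * g ^ c} := by
  have key : ∀ e ∈ E, e ≠ 0 → ∀ x ∈ {x : F | ∃ c : ℕ, x = w * g ^ c},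
      x * e ∈ {x : F | ∃ c : ℕ, x = w * g ^ c} := by
    rintro e he he0 _ ⟨c, rfl⟩
    obtain ⟨d, rfl⟩ := hE e he he0
    exact ⟨c + d, by rw [pow_add, mul_assoc]⟩
  intro e he he0 x
  refine ⟨fun hx => ?_, key e he he0 x⟩
  have := key _ (E.inv_mem he) (inv_ne_zero he0) _ hx
  rwa [mul_inv_cancel_right₀ he0] at this

section Arithmetic

variable {N b c r u x y : ℕ}

theorem cyclotomy_bound_of_le (hN : 0 < N) (hr : 1 < r) (hu : 0 < u)
    (hc : c * N + 1 = r ^ 2) (hb : c + b + 1 = r ^ 2) (hx : x + y + 1 = r * u)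
    (hy : b * (u - 1) ≤ (r - 1) * y) :
    (x : ℚ) ≤ ((r : ℚ) * u - 1) / N + ((N : ℚ) - 1) * ((r : ℚ) - u) / N := by
  have hN' : (0 : ℚ) < N := by exact_mod_cast hN
  have hr' : (0 : ℚ) < (r : ℚ) - 1 := by rw [sub_pos]; exact_mod_cast hr
  have hy' : (b : ℚ) * (u - 1) ≤ (r - 1) * y := by
    have := (Nat.cast_le (α := ℚ)).2 hy
    rwa [Nat.cast_mul, Nat.cast_mul, Nat.cast_pred hu, Nat.cast_pred (by omega)] at this
  have hc' : (c : ℚ) * N + 1 = r ^ 2 := by exact_mod_cast hc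
  have hb' : (c : ℚ) + b + 1 = r ^ 2 := by exact_mod_cast hb
  have hx' : (x : ℚ) + y + 1 = r * u := by exact_mod_cast hx
  have hbN : (b : ℚ) * N = (N - 1) * (r + 1) * (r - 1) := by
    linear_combination N * hb' - hc'
  have hyN : ((N : ℚ) - 1) * (r + 1) * (u - 1) ≤ N * y := by
    refine le_of_mul_le_mul_right ?_ hr'
    calc ((N : ℚ) - 1) * (r + 1) * (u - 1) * (r - 1) = N * (b * (u - 1)) := by
          linear_combination -(u - 1 : ℚ) * hbN
      _ ≤ N * ((r - 1) * y) := mul_le_mul_of_nonneg_left hy' hN'.le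
      _ = N * y * (r - 1) := by ring
  rw [← add_div, le_div_iff₀ hN']
  linear_combination hyN + N * hx'

theorem cyclotomy_bound_of_eq (hN : 0 < N) (hr : 1 < r) (hu : 0 < u)
    (hc : c * N + 1 = r ^ 2) (hb : c + b + 1 = r ^ 2) (hx : x + y + 1 = r * u)
    (hy : b * (u - 1) = (r - 1) * y) :
    (x : ℚ) = ((r : ℚ) * u - 1) / N + ((N : ℚ) - 1) * ((r : ℚ) - u) / N := by
  have hN' : (0 : ℚ) < N := by exact_mod_cast hN
  have hr' : (0 : ℚ) < (r : ℚ) - 1 := by rw [sub_pos]; exact_mod_cast hr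
  have hy' : (b : ℚ) * (u - 1) = (r - 1) * y := by
    have := congrArg (Nat.cast (R := ℚ)) hy
    rwa [Nat.cast_mul, Nat.cast_mul, Nat.cast_pred hu, Nat.cast_pred (by omega)] at this
  have hc' : (c : ℚ) * N + 1 = r ^ 2 := by exact_mod_cast hc
  have hb' : (c : ℚ) + b + 1 = r ^ 2 := by exact_mod_cast hb
  have hx' : (x : ℚ) + y + 1 = r * u := by exact_mod_cast hx
  have hyN : ((N : ℚ) - 1) * (r + 1) * (u - 1) = N * y := by
    refine mul_right_cancel₀ hr'.ne' ?_
    linear_combination N * hy' - (u - 1 : ℚ) * (N * hb' - hc')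
  rw [← add_div, eq_div_iff hN'.ne']
  linear_combination hyN + N * hx'

end Arithmetic

theorem stmt1 (p s m : ℕ) (hp : p.Prime) (hs : 0 < s) (hmeven : Even m) (hm : 0 < m)
    (q : ℕ) (hq : q = p ^ s)
    (K F : Type) [Field K] [Fintype K] [Field F] [Fintype F] [Algebra K F]
    (hK : Fintype.card K = q) (hF : Fintype.card F = q ^ m)
    (γ : F) (hγ : ∀ x : F, x ≠ 0 → ∃ k : ℕ, x = γ ^ k)
    (N : ℕ) (hNdvd : N ∣ q ^ m - 1) (hN2 : 2 < N) (hNle : N ≤ q ^ (m / 2))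
    (j : ℕ) (hj0 : 0 < j) (hj : (p : ZMod N) ^ j = -1)
    (hjmin : ∀ j' : ℕ, 0 < j' → (p : ZMod N) ^ j' = -1 → j ≤ j')
    (h2j : 2 * j ∣ s * m) (hodd : Odd (s * m / (2 * j)))
    (l i : ℕ) (hl : l ≤ m) (hi : i ≤ N - 1) :
    ∃ d : ℕ,
      IsGreatest
        {k : ℕ | ∃ L : Submodule K F, Module.finrank K L = l ∧
          k = Set.ncard ((L : Set F) ∩ {x : F | ∃ c : ℕ, x = γ ^ i * (γ ^ N) ^ c})} d ∧
      (d : ℚ) =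
        if 2 * l ≤ m then (q : ℚ) ^ l - 1
        else ((q : ℚ) ^ l - 1) / N +
          ((N : ℚ) - 1) * ((q : ℚ) ^ (m / 2) - (q : ℚ) ^ (l - m / 2)) / N := by
  classical
  obtain ⟨h, rfl⟩ := hmeven.exists_two_nsmul
  simp only [smul_eq_mul] at *
  have hh : 2 * h / 2 = h := by omega
  rw [hh] at *
  have hq1 : 1 < q := by rw [← hK]; exact Fintype.one_lt_card
  have hdim : Module.finrank K F = 2 * h := by
    have h1 := Module.card_eq_pow_finrank (K := K) (V := F)
    rw [hF, hK] at h1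
    exact (Nat.pow_right_injective hq1 h1).symm
  obtain ⟨E, hE⟩ := exists_intermediateField_finrank_eq_half hdim
  have hr : 1 < q ^ h := Nat.one_lt_pow (by omega) hq1
  have hr2 : q ^ (2 * h) = (q ^ h) ^ 2 := by rw [mul_comm, pow_mul]
  have hcardF : 2 < Fintype.card F := by rw [hF, hr2]; nlinarith
  obtain ⟨hγ0, hord⟩ := orderOf_eq_card_sub_one hcardF hγ
  have hNr : N ∣ q ^ h + 1 := by
    rw [hq, ← pow_mul]
    rw [mul_left_comm] at h2j hodd
    exact dvd_pow_add_one_of_pow_eq_neg_one hj h2j hodd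
  have hfac : Fintype.card F - 1 = (q ^ h - 1) * (q ^ h + 1) := by
    rw [hF, hr2, mul_comm, ← Nat.sq_sub_sq, one_pow]
  set C : Set F := {x : F | ∃ c : ℕ, x = γ ^ i * (γ ^ N) ^ c} with hCdef
  have hw : γ ^ i ≠ 0 := pow_ne_zero i hγ0
  have hwC : γ ^ i ∈ C := ⟨0, by simp⟩
  have hEpow : ∀ e ∈ E.toSubfield, e ≠ 0 → ∃ c : ℕ, e = (γ ^ N) ^ c := by
    intro e he he0
    refine exists_pow_eq_of_pow_eq_one hγ (hord.trans hfac) hr hNr he0 ?_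
    have h1 := FiniteField.pow_card_sub_one_eq_one (⟨e, he⟩ : E)
      (fun h0 => he0 (congrArg Subtype.val h0))
    rw [Module.card_eq_pow_finrank (K := K) (V := E), hE, hK] at h1
    exact congrArg Subtype.val h1
  have hCE : ∀ e ∈ E, e ≠ 0 → ∀ x, x * e ∈ C ↔ x ∈ C := mul_mem_iff_of_subfield_pow hEpow
  have hC0 : ∀ x ∈ C, x ≠ 0 := by
    rintro _ ⟨c, rfl⟩
    exact mul_ne_zero hw (pow_ne_zero _ (pow_ne_zero _ hγ0))
  have hEC : ∀ x ∈ E.toSubalgebra.toSubmodule.map (LinearMap.mulLeft K (γ ^ i)),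
      x ≠ 0 → x ∈ C := by
    rintro _ ⟨e, he, rfl⟩ hx
    exact (hCE e he (right_ne_zero_of_mul hx) _).2 hwC
  have hwE : Module.finrank K (E.toSubalgebra.toSubmodule.map (LinearMap.mulLeft K (γ ^ i))) = h :=
    (finrank_map_mulLeft hw _).trans hE
  have hsplit := fun L : Submodule K F => ncard_add_ncard_compl_inter L C hC0
  by_cases hlh : l ≤ h
  · rw [if_pos (by omega)]
    obtain ⟨U, -, hUE, hU⟩ := Submodule.exists_between_finrank_eq
      (bot_le (a := E.toSubalgebra.toSubmodule.map (LinearMap.mulLeft K (γ ^ i))))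
      (n := l) (by simp) (by omega)
    refine ⟨q ^ l - 1, ⟨⟨U, hU, ?_⟩, ?_⟩, ?_⟩
    · have h1 := hsplit U
      have h2 : {x : F | (x ≠ 0 ∧ x ∉ C) ∧ x ∈ U} = ∅ := by
        rw [Set.eq_empty_iff_forall_notMem]
        rintro x ⟨⟨hx0, hxC⟩, hxU⟩
        exact hxC (hEC x (hUE hxU) hx0)
      rw [h2, Set.ncard_empty, hU, hK] at h1
      omega
    · rintro _ ⟨L, hL, rfl⟩
      have h1 := hsplit L
      rw [hL, hK] at h1
      omega
    · rw [Nat.cast_pred (pow_pos (by omega) l), Nat.cast_pow]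
  · rw [if_neg (by omega)]
    obtain ⟨U, hEU, -, hU⟩ := Submodule.exists_between_finrank_eq
      (le_top (a := E.toSubalgebra.toSubmodule.map (LinearMap.mulLeft K (γ ^ i))))
      (n := l) (by omega) (by rw [finrank_top]; omega)
    have hu : 0 < q ^ (l - h) := pow_pos (by omega) _
    have hQ : 0 < q ^ (2 * h) := pow_pos (by omega) _
    have hc : C.ncard * N + 1 = (q ^ h) ^ 2 := by
      have h1 := ncard_cyclotomyClass_mul i hγ0 hord (by rwa [hF]) (N := N) (by omega)
      rw [h1, hF, ← hr2]
      omega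
    have hb : C.ncard + {x : F | x ≠ 0 ∧ x ∉ C}.ncard + 1 = (q ^ h) ^ 2 := by
      have h1 := hsplit ⊤
      simpa [hdim, hK, hr2] using h1
    have hlr : q ^ l = q ^ h * q ^ (l - h) := by rw [← pow_add]; congr 1; omega
    have hval := cyclotomy_bound_of_eq (by omega) hr hu hc hb
      (by rw [hsplit U, hU, hK, hlr])
      (by have := ncard_compl_inter_eq E hE hdim U C hCE hw hwC hEU
          rwa [hU, hK] at this)
    have hlr' : (q : ℚ) ^ l = (q ^ h : ℕ) * (q ^ (l - h) : ℕ) := by exact_mod_cast hlr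
    refine ⟨((U : Set F) ∩ C).ncard, ⟨⟨U, hU, rfl⟩, ?_⟩, ?_⟩
    · rintro _ ⟨L, hL, rfl⟩
      have hle := cyclotomy_bound_of_le (by omega) hr hu hc hb
        (by rw [hsplit L, hL, hK, hlr])
        (by have := le_ncard_compl_inter E hE hdim L C hCE
            rwa [hL, hK] at this)
      rw [← hval] at hle
      exact_mod_cast hle
    · rw [hval, hlr']
      push_cast
      rfl
end

section
/- Suppose q^{m/2} ≡ −1 (mod N). Let 0 ≤ l ≤ m/2, let 0 ≤ i ≤ N−1, and let L be any F_q-subspace of F_Q with dim_{F_q} L = l such that L ⊆ γ^i·F_{q^{m/2}}. Then |L ∩ C_i^{(N)}| = q^l − 1; in other words, every nonzero element of L lies in C_i^{(N)}. -/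
/-- A nonzero element whose powers exhaust the nonzero elements of a finite field `F` has
order `|F| - 1`. -/
theorem orderOf_eq_card_sub_one_of_forall_eq_pow {F : Type*} [Field F] [Fintype F] {γ : F}
    (hγ0 : γ ≠ 0) (hγ : ∀ x : F, x ≠ 0 → ∃ k : ℕ, x = γ ^ k) :
    orderOf γ = Fintype.card F - 1 := by
  classical
  have h : orderOf (Units.mk0 γ hγ0) = Nat.card Fˣ := by
    refine orderOf_eq_card_of_forall_mem_zpowers fun x => ?_
    obtain ⟨k, hk⟩ := hγ x x.ne_zero
    exact ⟨k, Units.ext (by simp [hk])⟩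
  rw [← Fintype.card_units, ← Nat.card_eq_fintype_card, ← h, ← orderOf_units, Units.val_mk0]

/-- If `γ` has order `s ^ 2 - 1`, then a power of `γ` fixed by `x ↦ x ^ s` has exponent
divisible by `s + 1`. -/
theorem add_one_dvd_of_pow_pow_eq_self {F : Type*} [Field F] {γ : F} (hγ0 : γ ≠ 0) {s k : ℕ}
    (hs : 2 ≤ s) (hord : orderOf γ = s ^ 2 - 1) (h : (γ ^ k) ^ s = γ ^ k) : s + 1 ∣ k := by
  obtain ⟨t, rfl⟩ : ∃ t, s = t + 1 := ⟨s - 1, by omega⟩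
  have h1 : γ ^ (k * t) = 1 := by
    have h2 : γ ^ (k * t) * γ ^ k = 1 * γ ^ k := by
      rw [← pow_add, one_mul, ← mul_add_one, pow_mul, h]
    exact mul_right_cancel₀ (pow_ne_zero k hγ0) h2
  have h3 := orderOf_dvd_of_pow_eq_one h1
  have h4 : (t + 1) ^ 2 - 1 = (t + 1 + 1) * t := by
    rw [Nat.sub_eq_iff_eq_add (Nat.one_le_pow _ _ (by omega))]
    ring
  rw [hord, h4] at h3
  exact Nat.dvd_of_mul_dvd_mul_right (by omega) h3

theorem stmt3 (q m : ℕ) (hq : IsPrimePow q) (hmeven : Even m) (hm : 2 ≤ m)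
    (K F : Type) [Field K] [Fintype K] [Field F] [Fintype F] [Algebra K F]
    (hK : Fintype.card K = q) (hF : Fintype.card F = q ^ m)
    (γ : F) (hγ : ∀ x : F, x ≠ 0 → ∃ k : ℕ, x = γ ^ k)
    (N : ℕ) (hN0 : 0 < N) (hNdvd : N ∣ q ^ m - 1)
    (hsemi : (q : ZMod N) ^ (m / 2) = -1)
    (l i : ℕ) (hl : 2 * l ≤ m) (hi : i ≤ N - 1)
    (L : Submodule K F) (hdim : Module.finrank K L = l)
    (hsub : (L : Set F) ⊆ (fun x => γ ^ i * x) '' {x : F | x ^ q ^ (m / 2) = x}) :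
    Set.ncard ((L : Set F) ∩ {x : F | ∃ k : ℕ, x = γ ^ i * (γ ^ N) ^ k}) = q ^ l - 1 := by
  classical
  have hs : 2 ≤ q ^ (m / 2) := hq.two_le.trans (Nat.le_self_pow (by omega) q)
  have hsq : q ^ m = (q ^ (m / 2)) ^ 2 := by
    rw [← pow_mul, Nat.div_mul_cancel hmeven.two_dvd]
  have hγ0 : γ ≠ 0 := by
    rintro rfl
    have hcard : Fintype.card F ≤ 2 := by
      refine (Finset.card_le_card (t := {0, 1}) fun x _ => ?_).trans Finset.card_le_two
      by_cases hx : x = 0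
      · simp [hx]
      · obtain ⟨k, rfl⟩ := hγ x hx
        cases k <;> simp
    rw [hF, hsq] at hcard
    nlinarith
  have hord : orderOf γ = (q ^ (m / 2)) ^ 2 - 1 := by
    rw [orderOf_eq_card_sub_one_of_forall_eq_pow hγ0 hγ, hF, hsq]
  have hN : N ∣ q ^ (m / 2) + 1 := by
    rw [← ZMod.natCast_eq_zero_iff]
    push_cast
    rw [hsemi, neg_add_cancel]
  have hset : (L : Set F) ∩ {x : F | ∃ k : ℕ, x = γ ^ i * (γ ^ N) ^ k} = (L : Set F) \ {0} := by
    ext x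
    refine and_congr_right fun hxL => ⟨?_, fun hx0 => ?_⟩
    · rintro ⟨k, rfl⟩
      simp [hγ0]
    · obtain ⟨y, hy, rfl⟩ := hsub hxL
      have hy0 : y ≠ 0 := by
        rintro rfl
        simp at hx0
      obtain ⟨k, rfl⟩ := hγ y hy0
      obtain ⟨j, rfl⟩ := hN.trans (add_one_dvd_of_pow_pow_eq_self hγ0 hs hord hy)
      exact ⟨j, by simp only [pow_mul]⟩
  have hL : (L : Set F).ncard = q ^ l := by
    rw [← Nat.card_coe_set_eq, ← hdim, ← hK, ← Nat.card_eq_fintype_card]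
    exact Module.natCard_eq_pow_finrank (K := K) (V := L)
  rw [hset, Set.ncard_sdiff_singleton_of_mem L.zero_mem, hL]
end

section
/- Suppose q^{m/2} ≡ −1 (mod N). Let m/2 ≤ l ≤ m and let L be any F_q-subspace of F_Q with dim_{F_q} L = l. Then |L ∩ C_0^{(N)}| ≤ (q^l − 1)/N + (N−1)(q^{m/2} − q^{l−m/2})/N. -/
/-- An element whose powers exhaust the nonzero elements of a finite field with more than two
elements is a primitive root of order `Fintype.card F - 1`. -/
theorem isPrimitiveRoot_card_sub_one_of_forall_eq_pow {F : Type*} [Field F] [Fintype F]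
    (hF : 2 < Fintype.card F) {γ : F} (hγ : ∀ x : F, x ≠ 0 → ∃ k : ℕ, x = γ ^ k) :
    IsPrimitiveRoot γ (Fintype.card F - 1) := by
  classical
  have hγ0 : γ ≠ 0 := by
    rintro rfl
    have hsub : (Finset.univ : Finset F) ⊆ {0, 1} := by
      intro x _
      by_cases hx : x = 0
      · simp [hx]
      · obtain ⟨k, rfl⟩ := hγ x hx
        rcases k with _ | k <;> simp
    have := (Finset.card_le_card hsub).trans Finset.card_le_two
    rw [Finset.card_univ] at this
    omega
  have hgen : ∀ u : Fˣ, u ∈ Subgroup.zpowers (Units.mk0 γ hγ0) := by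
    intro u
    obtain ⟨k, hk⟩ := hγ u u.ne_zero
    exact ⟨k, Units.ext (by simp [hk])⟩
  have hord : orderOf (Units.mk0 γ hγ0) = Fintype.card F - 1 := by
    rw [orderOf_eq_card_of_forall_mem_zpowers hgen, Nat.card_eq_fintype_card,
      Fintype.card_units]
  have := IsPrimitiveRoot.orderOf (Units.mk0 γ hγ0)
  rw [hord] at this
  simpa using IsPrimitiveRoot.coe_units_iff.mpr this

/-- The elements of `F` fixed by the `n`-th power of the `K`-Frobenius, as a `K`-subspace. -/
noncomputable def frobeniusFixed (K F : Type*) [Field K] [Fintype K] [Field F] [Algebra K F]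
    (n : ℕ) : Submodule K F :=
  LinearMap.eqLocus ((FiniteField.frobeniusAlgHom K F ^ n).toLinearMap) LinearMap.id

theorem mem_frobeniusFixed {K F : Type*} [Field K] [Fintype K] [Field F] [Algebra K F]
    {n : ℕ} {x : F} : x ∈ frobeniusFixed K F n ↔ x ^ Fintype.card K ^ n = x := by
  simp [frobeniusFixed, LinearMap.mem_eqLocus, AlgHom.coe_pow, FiniteField.coe_frobeniusAlgHom,
    pow_iterate]

theorem mem_frobeniusFixed_iff_of_ne_zero {K F : Type*} [Field K] [Fintype K] [Field F]
    [Algebra K F] {n : ℕ} {x : F} (hx : x ≠ 0) :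
    x ∈ frobeniusFixed K F n ↔ x ^ (Fintype.card K ^ n - 1) = 1 := by
  have hpos : 0 < Fintype.card K ^ n := pow_pos Fintype.card_pos n
  rw [mem_frobeniusFixed]
  conv_lhs => rw [← Nat.sub_add_cancel hpos, pow_succ]
  exact mul_eq_right₀ hx

/-- If `F` has a primitive root of order `|K| ^ n - 1`, the space fixed by the `n`-th power of
Frobenius has dimension `n`. -/
theorem finrank_frobeniusFixed {K F : Type*} [Field K] [Fintype K] [Field F] [Finite F]
    [Algebra K F] {n : ℕ} (hn : n ≠ 0) {ζ : F}
    (hζ : IsPrimitiveRoot ζ (Fintype.card K ^ n - 1)) :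
    Module.finrank K (frobeniusFixed K F n) = n := by
  classical
  have hK : 1 < Fintype.card K := Fintype.one_lt_card
  have h1 : 1 < Fintype.card K ^ n := Nat.one_lt_pow hn hK
  have hset : (frobeniusFixed K F n : Set F) =
      ↑(insert 0 (Polynomial.nthRootsFinset (Fintype.card K ^ n - 1) (1 : F))) := by
    ext x
    by_cases hx : x = 0
    · simp [hx]
    · simp [hx, mem_frobeniusFixed_iff_of_ne_zero,
        Polynomial.mem_nthRootsFinset (show 0 < Fintype.card K ^ n - 1 by omega)]
  have h0 : (0 : F) ∉ Polynomial.nthRootsFinset (Fintype.card K ^ n - 1) (1 : F) := by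
    rw [Polynomial.mem_nthRootsFinset (by omega), zero_pow (by omega)]
    exact zero_ne_one
  have hcard : Nat.card (frobeniusFixed K F n) = Fintype.card K ^ n := by
    have : Nat.card (frobeniusFixed K F n) = (frobeniusFixed K F n : Set F).ncard := rfl
    rw [this, hset, Set.ncard_coe_finset, Finset.card_insert_of_notMem h0,
      hζ.card_nthRootsFinset]
    omega
  rw [Module.natCard_eq_pow_finrank (K := K), Nat.card_eq_fintype_card] at hcard
  exact Nat.pow_right_injective hK hcard

/-- Two subspaces `L` and `x • E` meet in dimension at least `dim L + dim E - dim F`; counted by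
the nonzero elements of `E`. -/
theorem pow_finrank_sub_le_card_filter_mul_mem {K F : Type*} [Field K] [Fintype K] [Field F]
    [Fintype F] [Algebra K F] (L E : Submodule K F) {d : ℕ}
    (hd : d + Module.finrank K F ≤ Module.finrank K L + Module.finrank K E)
    {x : F} (hx : x ≠ 0) (R : Finset F) (hR : ∀ c ∈ E, c ≠ 0 → c ∈ R) [DecidablePred (· ∈ L)] :
    Fintype.card K ^ d ≤ (R.filter (fun c => x * c ∈ L)).card + 1 := by
  classical
  have hinj : Function.Injective (LinearMap.mulLeft K x) := mul_right_injective₀ hx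
  have hmap : Module.finrank K (E.map (LinearMap.mulLeft K x)) = Module.finrank K E :=
    (Submodule.equivMapOfInjective _ hinj E).finrank_eq.symm
  have hsum := Submodule.finrank_sup_add_finrank_inf_eq L (E.map (LinearMap.mulLeft K x))
  have hle := Submodule.finrank_le (L ⊔ E.map (LinearMap.mulLeft K x))
  have hdim : d ≤ Module.finrank K ↥(L ⊓ E.map (LinearMap.mulLeft K x)) := by omega
  have hsub : ((L ⊓ E.map (LinearMap.mulLeft K x) : Submodule K F) : Set F) ⊆
      ↑(insert 0 ((R.filter (fun c => x * c ∈ L)).image (x * ·))) := by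
    rintro y ⟨hyL, c, hc, rfl⟩
    by_cases hc0 : c = 0
    · simp [hc0]
    · have hcR := hR c hc hc0
      have hcL : x * c ∈ L := hyL
      simp only [Finset.coe_insert, Finset.coe_image, Finset.coe_filter]
      exact Or.inr ⟨c, ⟨hcR, hcL⟩, rfl⟩
  calc Fintype.card K ^ d
      ≤ Fintype.card K ^ Module.finrank K ↥(L ⊓ E.map (LinearMap.mulLeft K x)) :=
        Nat.pow_le_pow_right Fintype.card_pos hdim
    _ = ((L ⊓ E.map (LinearMap.mulLeft K x) : Submodule K F) : Set F).ncard := by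
        rw [← Nat.card_eq_fintype_card, ← Module.natCard_eq_pow_finrank]
        rfl
    _ ≤ _ := Set.ncard_le_ncard hsub (Finset.finite_toSet _)
    _ ≤ _ := by
        rw [Set.ncard_coe_finset]
        exact (Finset.card_insert_le _ _).trans (Nat.succ_le_succ Finset.card_image_le)

/-- Double counting of the pairs `(x, c)` with `x ∈ S`, `c ∈ R`, `x * c ∈ L`, when `S` is stable
under multiplication and division by `R`. -/
theorem sum_card_filter_mul_mem {F : Type*} [Field F] (S R : Finset F) (p : F → Prop)
    [DecidablePred p] (hR0 : ∀ c ∈ R, c ≠ 0)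
    (hS : ∀ c ∈ R, ∀ x, x * c ∈ S ↔ x ∈ S) :
    ∑ x ∈ S, (R.filter (fun c => p (x * c))).card = R.card * (S.filter p).card := by
  refine (Finset.sum_card_bipartiteAbove_eq_sum_card_bipartiteBelow
    (fun x c => p (x * c))).trans ?_
  rw [← smul_eq_mul, ← Finset.sum_const]
  refine Finset.sum_congr rfl fun c hc => ?_
  refine Finset.card_bij' (fun x _ => x * c) (fun y _ => y * c⁻¹) ?_ ?_ ?_ ?_
  · intro x hx
    simp only [Finset.mem_bipartiteBelow, Finset.mem_filter] at hx ⊢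
    exact ⟨(hS c hc x).mpr hx.1, hx.2⟩
  · intro y hy
    have : y * c⁻¹ * c = y := inv_mul_cancel_right₀ (hR0 c hc) y
    simp only [Finset.mem_bipartiteBelow, Finset.mem_filter] at hy ⊢
    rw [← hS c hc, this]
    exact hy
  · intro x _
    exact mul_inv_cancel_right₀ (hR0 c hc) x
  · intro y _
    exact inv_mul_cancel_right₀ (hR0 c hc) y

theorem stmt4 (q m : ℕ) (hq : IsPrimePow q) (hmeven : Even m) (hm : 2 ≤ m)
    (K F : Type) [Field K] [Fintype K] [Field F] [Fintype F] [Algebra K F]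
    (hK : Fintype.card K = q) (hF : Fintype.card F = q ^ m)
    (γ : F) (hγ : ∀ x : F, x ≠ 0 → ∃ k : ℕ, x = γ ^ k)
    (N : ℕ) (hN0 : 0 < N) (hNdvd : N ∣ q ^ m - 1)
    (hsemi : (q : ZMod N) ^ (m / 2) = -1)
    (l : ℕ) (hl1 : m / 2 ≤ l) (hl2 : l ≤ m)
    (L : Submodule K F) (hdim : Module.finrank K L = l) :
    (Set.ncard ((L : Set F) ∩ {x : F | ∃ k : ℕ, x = (γ ^ N) ^ k}) : ℚ) ≤
      ((q : ℚ) ^ l - 1) / N +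
        ((N : ℚ) - 1) * ((q : ℚ) ^ (m / 2) - (q : ℚ) ^ (l - m / 2)) / N := by
  classical
  obtain ⟨n, rfl⟩ := hmeven
  have hn : n ≠ 0 := by omega
  have hhalf : (n + n) / 2 = n := by omega
  rw [hhalf] at hsemi hl1 ⊢
  have hq1 : 1 < q := hq.one_lt
  have hr1 : 1 < q ^ n := Nat.one_lt_pow hn hq1
  have hQ : q ^ (n + n) - 1 = (q ^ n - 1) * (q ^ n + 1) := by
    rw [mul_comm, ← Nat.sq_sub_sq, sq, one_pow, pow_add]
  have hN1 : N ∣ q ^ n + 1 := by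
    rw [← CharP.cast_eq_zero_iff (ZMod N) N]
    push_cast
    rw [hsemi, neg_add_cancel]
  obtain ⟨k, hk⟩ := hN1
  have hk0 : 0 < k := Nat.pos_of_ne_zero (by rintro rfl; omega)
  have hfinF : Module.finrank K F = n + n := by
    have h := Module.card_eq_pow_finrank (K := K) (V := F)
    rw [hK, hF] at h
    exact (Nat.pow_right_injective hq1 h).symm
  have hγp : IsPrimitiveRoot γ (q ^ (n + n) - 1) := by
    rw [← hF]
    refine isPrimitiveRoot_card_sub_one_of_forall_eq_pow ?_ hγ
    rw [hF, pow_add]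
    nlinarith
  have hQpos : 0 < q ^ (n + n) - 1 := by
    rw [hQ]
    exact Nat.mul_pos (by omega) (by omega)
  have hζ : IsPrimitiveRoot (γ ^ (q ^ n + 1)) (q ^ n - 1) :=
    hγp.pow hQpos (by rw [hQ, mul_comm])
  set M := (q ^ n - 1) * k with hM
  have hMpos : 0 < M := Nat.mul_pos (by omega) hk0
  have hβ : IsPrimitiveRoot (γ ^ N) M :=
    hγp.pow hQpos (by rw [hQ, hk, hM]; ring)
  have hE : Module.finrank K (frobeniusFixed K F n) = n :=
    finrank_frobeniusFixed hn (by rw [hK]; exact hζ)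
  set R := Polynomial.nthRootsFinset (q ^ n - 1) (1 : F) with hRdef
  set C := Polynomial.nthRootsFinset M (1 : F) with hCdef
  have hmemR : ∀ c : F, c ∈ R ↔ c ^ (q ^ n - 1) = 1 := fun c =>
    Polynomial.mem_nthRootsFinset (by omega) 1
  have hmemC : ∀ c : F, c ∈ C ↔ c ^ M = 1 := fun c =>
    Polynomial.mem_nthRootsFinset hMpos 1
  have hR0 : ∀ c ∈ R, c ≠ 0 := by
    rintro c hc rfl
    rw [hmemR, zero_pow (by omega)] at hc
    exact zero_ne_one hc
  have hC0 : (0 : F) ∉ C := by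
    rw [hmemC, zero_pow hMpos.ne']
    exact zero_ne_one
  have hRM : ∀ c ∈ R, c ^ M = 1 := by
    intro c hc
    rw [hM, pow_mul, (hmemR c).mp hc, one_pow]
  set S := (insert 0 C)ᶜ with hSdef
  have hmemS : ∀ x : F, x ∈ S ↔ x ≠ 0 ∧ x ^ M ≠ 1 := by
    intro x
    simp [hSdef, hmemC]
  have hScard : S.card + (M + 1) = q ^ (n + n) := by
    rw [← hF, ← hβ.card_nthRootsFinset, ← hCdef, ← Finset.card_insert_of_notMem hC0, hSdef,
      Finset.card_compl_add_card]
  have hcount := sum_card_filter_mul_mem S R (· ∈ L) hR0 (fun c hc x => by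
    simp [hmemS, mul_pow, hRM c hc, hR0 c hc])
  have hlow : ∀ x ∈ S, q ^ (l - n) ≤ (R.filter (fun c => x * c ∈ L)).card + 1 := by
    intro x hx
    rw [← hK]
    refine pow_finrank_sub_le_card_filter_mul_mem L (frobeniusFixed K F n) ?_
      ((hmemS x).mp hx).1 R ?_
    · rw [hdim, hE, hfinF]
      omega
    · intro c hc hc0
      rw [hmemR, ← hK]
      exact (mem_frobeniusFixed_iff_of_ne_zero hc0).mp hc
  have hsum : S.card * q ^ (l - n) ≤ (q ^ n - 1) * (S.filter (· ∈ L)).card + S.card := by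
    have h := Finset.sum_le_sum hlow
    rw [Finset.sum_add_distrib, hcount, Finset.sum_const, Finset.sum_const, smul_eq_mul,
      smul_eq_mul, mul_one, hRdef, hζ.card_nthRootsFinset] at h
    exact h
  have hinter : (L : Set F) ∩ {x : F | ∃ k : ℕ, x = (γ ^ N) ^ k} = ↑(C.filter (· ∈ L)) := by
    ext x
    simp only [Set.mem_inter_iff, SetLike.mem_coe, Set.mem_ofPred_eq, Finset.coe_filter, hmemC]
    rw [and_comm]
    refine and_congr_left fun _ => ⟨?_, fun hx => ?_⟩
    · rintro ⟨j, rfl⟩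
      rw [← pow_mul, mul_comm, pow_mul, hβ.pow_eq_one, one_pow]
    · have : NeZero M := ⟨hMpos.ne'⟩
      obtain ⟨i, _, hi⟩ := hβ.eq_pow_of_pow_eq_one hx
      exact ⟨i, hi.symm⟩
  have hLcard : (S.filter (· ∈ L)).card + ((C.filter (· ∈ L)).card + 1) = q ^ l := by
    have hL : (Finset.univ.filter (· ∈ L)).card = q ^ l := by
      rw [← hdim, ← hK, ← Module.card_eq_pow_finrank (K := K) (V := L), Fintype.card_subtype]
    have h0 : (0 : F) ∉ C.filter (· ∈ L) := by simp [hC0]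
    rw [← hL, ← Finset.card_insert_of_notMem h0,
      ← Finset.card_filter_add_card_filter_not (s := Finset.univ.filter (· ∈ L)) (· ∈ S)]
    congr 2
    · ext x
      simp [and_comm]
    · ext x
      by_cases hx : x = 0
      · simp [hx, hSdef]
      · simp [hx, hSdef, and_comm]
  rw [hinter, Set.ncard_coe_finset]
  have hql : q ^ l = q ^ (l - n) * q ^ n := by
    rw [← pow_add, Nat.sub_add_cancel hl1]
  have hrN : (1 : ℚ) < (q : ℚ) ^ n := by exact_mod_cast hr1
  have hMq : (M : ℚ) = ((q : ℚ) ^ n - 1) * k := by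
    rw [hM, Nat.cast_mul, Nat.cast_sub hr1.le]
    push_cast
    ring
  have hkq : (q : ℚ) ^ n + 1 = N * k := by exact_mod_cast hk
  have hNq : (0 : ℚ) < N := by exact_mod_cast hN0
  have hSq : (S.card : ℚ) = ((q : ℚ) ^ n - 1) * (k * (N - 1)) := by
    have h : (S.card : ℚ) + (M + 1) = (q : ℚ) ^ n * (q : ℚ) ^ n := by
      rw [← pow_add]
      exact_mod_cast hScard
    rw [hMq] at h
    linear_combination h + ((q : ℚ) ^ n - 1) * hkq
  have hsumq : (S.card : ℚ) * (q : ℚ) ^ (l - n) ≤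
      ((q : ℚ) ^ n - 1) * (S.filter (· ∈ L)).card + S.card := by
    have h : ((S.card * q ^ (l - n) : ℕ) : ℚ) ≤
        (((q ^ n - 1) * (S.filter (· ∈ L)).card + S.card : ℕ) : ℚ) := by exact_mod_cast hsum
    rw [Nat.cast_add, Nat.cast_mul, Nat.cast_mul, Nat.cast_sub hr1.le] at h
    simpa using h
  have hT : (k : ℚ) * (N - 1) * ((q : ℚ) ^ (l - n) - 1) ≤ (S.filter (· ∈ L)).card := by
    rw [hSq] at hsumq
    refine le_of_mul_le_mul_left ?_ (sub_pos.mpr hrN)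
    linarith
  have hLq : ((S.filter (· ∈ L)).card : ℚ) + ((C.filter (· ∈ L)).card + 1) =
      (q : ℚ) ^ (l - n) * (q : ℚ) ^ n := by
    rw [← pow_add, Nat.sub_add_cancel hl1]
    exact_mod_cast hLcard
  have hqlq : (q : ℚ) ^ l = (q : ℚ) ^ (l - n) * (q : ℚ) ^ n := by exact_mod_cast hql
  rw [hqlq, ← add_div, le_div_iff₀ hNq]
  have hTN := mul_le_mul_of_nonneg_left hT hNq.le
  have hexp : (N : ℚ) * (k * (N - 1) * ((q : ℚ) ^ (l - n) - 1)) =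
      ((q : ℚ) ^ n + 1) * ((N - 1) * ((q : ℚ) ^ (l - n) - 1)) := by
    rw [hkq]
    ring
  rw [hexp] at hTN
  linear_combination hTN + (N : ℚ) * hLq
end

section
/- Let v be the unique integer with 0 ≤ v ≤ m/2 − 1 and q^v ≤ (q^{m/2}+1)/N − 1 < q^{v+1}. Let u_i, u_j be integers with m ≥ u_i + 1 > u_i ≥ m/2 ≥ u_j > u_j − 1 ≥ 0 and u_i − u_j ≥ m/2 − v − 1. Then f(u_i + 1) + f(u_j − 1) ≥ f(u_i) + f(u_j). -/
/-- The function `f` from Lemma 2: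
`f(l) = q^l - 1` for `0 ≤ l ≤ m/2` and
`f(l) = (q^l - 1)/N + (N-1)(q^{m/2} - q^{l-m/2})/N` for `m/2 ≤ l ≤ m`. -/
noncomputable def ghwf (q N m l : ℕ) : ℚ :=
  if 2 * l ≤ m then (q : ℚ) ^ l - 1
  else ((q : ℚ) ^ l - 1) / N +
    ((N : ℚ) - 1) * ((q : ℚ) ^ (m / 2) - (q : ℚ) ^ (l - m / 2)) / N

theorem ghwf_of_le {q N m l : ℕ} (hl : 2 * l ≤ m) : ghwf q N m l = (q : ℚ) ^ l - 1 :=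
  if_pos hl

/-- The second formula for `ghwf` also holds at `l = h`, the midpoint of the range. -/
theorem ghwf_add {q N h : ℕ} (hN : N ≠ 0) (a : ℕ) :
    ghwf q N (h + h) (h + a) =
      ((q : ℚ) ^ (h + a) - 1) / N + ((N : ℚ) - 1) * ((q : ℚ) ^ h - (q : ℚ) ^ a) / N := by
  have hN' : (N : ℚ) ≠ 0 := by exact_mod_cast hN
  have hh : (h + h) / 2 = h := by omega
  unfold ghwf
  split_ifs with hc
  · obtain rfl : a = 0 := by omega
    field_simp
    ring
  · rw [hh, Nat.add_sub_cancel_left]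

theorem ghwf_succ_sub {q N h K : ℕ} (hN : N ≠ 0) (hK : q ^ h + 1 = N * K) (a : ℕ) :
    ghwf q N (h + h) (h + a + 1) - ghwf q N (h + h) (h + a) =
      ((q : ℚ) - 1) * ((q : ℚ) ^ a * ((K : ℚ) - 1)) := by
  have hN' : (N : ℚ) ≠ 0 := by exact_mod_cast hN
  have hK' : (q : ℚ) ^ h = N * K - 1 := by
    rw [eq_sub_iff_add_eq]
    exact_mod_cast hK
  rw [add_assoc, ghwf_add hN, ghwf_add hN]
  simp only [pow_add, pow_one, hK']
  field_simp
  ring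

theorem stmt8 (q m N : ℕ) (hq : 2 ≤ q) (hmeven : Even m) (hm : 2 ≤ m)
    (hN : 2 < N) (hNle : 2 * N ≤ q ^ (m / 2) + 1)
    (hsemi : (q : ZMod N) ^ (m / 2) = -1)
    (v : ℕ) (hv0 : v ≤ m / 2 - 1)
    (hv1 : q ^ v ≤ (q ^ (m / 2) + 1) / N - 1)
    (hv2 : (q ^ (m / 2) + 1) / N - 1 < q ^ (v + 1))
    (ui uj : ℕ) (h1 : ui + 1 ≤ m) (h2 : m / 2 ≤ ui) (h3 : uj ≤ m / 2) (h4 : 1 ≤ uj)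
    (h5 : m / 2 - v - 1 ≤ ui - uj) :
    ghwf q N m ui + ghwf q N m uj ≤ ghwf q N m (ui + 1) + ghwf q N m (uj - 1) := by
  obtain ⟨h, rfl⟩ := hmeven
  rw [show (h + h) / 2 = h by omega] at *
  obtain ⟨a, rfl⟩ := Nat.exists_eq_add_of_le h2
  obtain ⟨c, rfl⟩ := Nat.exists_eq_add_of_le' h4
  have hdvd : N ∣ q ^ h + 1 := by
    rw [← ZMod.natCast_eq_zero_iff]
    push_cast
    rw [hsemi, neg_add_cancel]
  obtain ⟨K, hK⟩ := hdvd
  rw [hK, Nat.mul_div_cancel_left K (by omega)] at hv1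
  have hupper := ghwf_succ_sub (by omega : N ≠ 0) hK a
  have hlower : ghwf q N (h + h) (c + 1) - ghwf q N (h + h) c =
      ((q : ℚ) - 1) * (q : ℚ) ^ c := by
    rw [ghwf_of_le (by omega), ghwf_of_le (by omega)]
    ring
  have hpow : q ^ c + q ^ a ≤ q ^ a * K := calc
    q ^ c + q ^ a ≤ q ^ (a + v) + q ^ a := by
      gcongr
      · omega
      · omega
    _ = q ^ a * (q ^ v + 1) := by ring
    _ ≤ q ^ a * K := by
      have : 0 < q ^ v := by positivity
      gcongr
      omega
  have hpow' : (q : ℚ) ^ c ≤ (q : ℚ) ^ a * ((K : ℚ) - 1) := by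
    have : (q : ℚ) ^ c + (q : ℚ) ^ a ≤ (q : ℚ) ^ a * K := by exact_mod_cast hpow
    linarith
  have hq' : (0 : ℚ) ≤ (q : ℚ) - 1 := by
    have : (2 : ℚ) ≤ q := by exact_mod_cast hq
    linarith
  have hmul := mul_le_mul_of_nonneg_left hpow' hq'
  rw [Nat.add_sub_cancel]
  linarith
end

section
/- Let u_i, u_j be integers with m ≥ u_i + 1 > u_i ≥ u_j > u_j − 1 ≥ m/2. Then f(u_i + 1) + f(u_j − 1) ≥ f(u_i) + f(u_j). -/
/-- On the upper half of the range, `ghwf` is affine in `q ^ (l - m / 2)`. -/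
theorem ghwf_two_mul_add (q N k a : ℕ) (hN : N ≠ 0) :
    ghwf q N (2 * k) (k + a) =
      ((q : ℚ) ^ a * ((q : ℚ) ^ k + 1 - N) + ((N - 1) * (q : ℚ) ^ k - 1)) / N := by
  have hN' : (N : ℚ) ≠ 0 := by exact_mod_cast hN
  unfold ghwf
  split_ifs with h
  · obtain rfl : a = 0 := by omega
    field_simp
    rw [add_zero]
    ring
  · rw [Nat.mul_div_cancel_left k two_pos, Nat.add_sub_cancel_left]
    field_simp
    ring

theorem le_pow_add_one_of_pow_eq_neg_one {q N k : ℕ} (h : (q : ZMod N) ^ k = -1) :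
    N ≤ q ^ k + 1 := by
  refine Nat.le_of_dvd (Nat.succ_pos _) ((ZMod.natCast_eq_zero_iff _ _).mp ?_)
  push_cast
  rw [h, neg_add_cancel]

theorem pow_add_pow_le_pow_succ_add_pow {x : ℚ} (hx : 1 ≤ x) (b c : ℕ) :
    x ^ (b + 1 + c) + x ^ (b + 1) ≤ x ^ (b + 1 + c + 1) + x ^ b := by
  have h : 0 ≤ x ^ b * ((x ^ (c + 1) - 1) * (x - 1)) :=
    mul_nonneg (by positivity)
      (mul_nonneg (sub_nonneg.mpr (one_le_pow₀ hx)) (sub_nonneg.mpr hx))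
  linear_combination h

theorem stmt10 (q m N : ℕ) (hq : 2 ≤ q) (hmeven : Even m) (hm : 2 ≤ m)
    (hN : 2 < N) (hsemi : (q : ZMod N) ^ (m / 2) = -1)
    (ui uj : ℕ) (h1 : ui + 1 ≤ m) (h2 : uj ≤ ui) (h3 : m / 2 ≤ uj - 1) (h4 : 1 ≤ uj) :
    ghwf q N m ui + ghwf q N m uj ≤ ghwf q N m (ui + 1) + ghwf q N m (uj - 1) := by
  obtain ⟨k, rfl⟩ := hmeven.two_dvd
  rw [Nat.mul_div_cancel_left k two_pos] at hsemi h3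
  obtain ⟨b, rfl⟩ : ∃ b, uj = k + (b + 1) := ⟨uj - 1 - k, by omega⟩
  obtain ⟨c, rfl⟩ : ∃ c, ui = k + (b + 1 + c) := ⟨ui - (k + (b + 1)), by omega⟩
  have hN0 : N ≠ 0 := by omega
  rw [show k + (b + 1) - 1 = k + b by omega, add_assoc k (b + 1 + c) 1]
  simp only [ghwf_two_mul_add q N k _ hN0]
  rw [← add_div, ← add_div]
  have hD : (0 : ℚ) ≤ (q : ℚ) ^ k + 1 - N :=
    sub_nonneg.mpr (by exact_mod_cast le_pow_add_one_of_pow_eq_neg_one hsemi)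
  have hq1 : (1 : ℚ) ≤ q := by exact_mod_cast (by omega : 1 ≤ q)
  gcongr ?_ / _
  linear_combination mul_le_mul_of_nonneg_right (pow_add_pow_le_pow_succ_add_pow hq1 b c) hD
end

section
/- We have f(m) + f(0) ≥ 2·f(m/2); explicitly, (q^m − 1)/N ≥ 2(q^{m/2} − 1). Consequently, replacing two entries equal to m/2 in a sequence by one entry m and one entry 0 does not decrease the sum T(u) = Σ_i f(u_i). -/
theorem stmt11 (q m N : ℕ) (hq : 2 ≤ q) (hmeven : Even m) (hm : 2 ≤ m)
    (hN : 2 < N) (hNle : 2 * N ≤ q ^ (m / 2) + 1)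
    (hsemi : (q : ZMod N) ^ (m / 2) = -1) :
    2 * ghwf q N m (m / 2) ≤ ghwf q N m m + ghwf q N m 0 ∧
    2 * ((q : ℚ) ^ (m / 2) - 1) ≤ ((q : ℚ) ^ m - 1) / N := by
  obtain ⟨k, rfl⟩ := hmeven
  have hk : (k + k) / 2 = k := by omega
  have hk0 : 0 < k := by omega
  rw [hk] at hNle
  have hQ : 2 * (N : ℚ) ≤ (q : ℚ) ^ k + 1 := by exact_mod_cast hNle
  have hN0 : (2 : ℚ) < N := by exact_mod_cast hN
  have hmain : 2 * ((q : ℚ) ^ k - 1) ≤ ((q : ℚ) ^ (k + k) - 1) / N := by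
    rw [le_div_iff₀ (by linarith), pow_add]
    nlinarith
  have hmid : ghwf q N (k + k) k = (q : ℚ) ^ k - 1 := by
    rw [ghwf, if_pos (by omega)]
  have htop : ghwf q N (k + k) (k + k) = ((q : ℚ) ^ (k + k) - 1) / N := by
    rw [ghwf, if_neg (by omega), hk, Nat.add_sub_cancel]
    simp
  have hzero : ghwf q N (k + k) 0 = 0 := by simp [ghwf]
  rw [hk, hmid, htop, hzero, add_zero]
  exact ⟨hmain, hmain⟩
end

section
/- Let r_2 be an integer with 0 ≤ r_2 < m/2. Then f(m) + f(r_2) ≥ f(r_2 + m/2) + f(m/2). -/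
/-- Above `m / 2`, and also at `m / 2` where the two formulas agree, `ghwf` is given by the second
formula. -/
theorem ghwf_add_half {q N m : ℕ} (hN : N ≠ 0) (hm : Even m) (r : ℕ) :
    ghwf q N m (r + m / 2) = ((q : ℚ) ^ r * (q : ℚ) ^ (m / 2) - 1) / N +
      ((N : ℚ) - 1) * ((q : ℚ) ^ (m / 2) - (q : ℚ) ^ r) / N := by
  have hN' : (N : ℚ) ≠ 0 := Nat.cast_ne_zero.mpr hN
  obtain ⟨k, rfl⟩ := hm
  have hk : (k + k) / 2 = k := by omega
  rw [ghwf, hk]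
  split_ifs with h
  · obtain rfl : r = 0 := by omega
    simp only [zero_add, pow_zero]
    field_simp
    ring
  · rw [Nat.add_sub_cancel, pow_add]

theorem stmt12 (q m N : ℕ) (hq : 2 ≤ q) (hmeven : Even m) (hm : 2 ≤ m)
    (hN : 2 < N) (hNle : 2 * N ≤ q ^ (m / 2) + 1)
    (hsemi : (q : ZMod N) ^ (m / 2) = -1)
    (r2 : ℕ) (hr2 : 2 * r2 < m) :
    ghwf q N m (r2 + m / 2) + ghwf q N m (m / 2) ≤ ghwf q N m m + ghwf q N m r2 := by
  have hN0 : (0 : ℚ) < N := by exact_mod_cast (by omega : 0 < N)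
  have hmid : ghwf q N m (m / 2) = (q : ℚ) ^ (m / 2) - 1 := by
    rw [ghwf, if_pos (by omega)]
  have hlow : ghwf q N m r2 = (q : ℚ) ^ r2 - 1 := by
    rw [ghwf, if_pos hr2.le]
  have htop := ghwf_add_half (q := q) (by omega : N ≠ 0) hmeven (m / 2)
  rw [show m / 2 + m / 2 = m by obtain ⟨k, rfl⟩ := hmeven; omega] at htop
  rw [ghwf_add_half (by omega) hmeven, hmid, htop, hlow]
  have hpow : (q : ℚ) ^ r2 ≤ (q : ℚ) ^ (m / 2) :=
    pow_le_pow_right₀ (by exact_mod_cast (by omega : 1 ≤ q)) (by omega)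
  have hNQ : 2 * (N : ℚ) ≤ (q : ℚ) ^ (m / 2) + 1 := by exact_mod_cast hNle
  generalize (q : ℚ) ^ (m / 2) = Q at *
  generalize (q : ℚ) ^ r2 = x at *
  have hnonneg : 0 ≤ (Q - x) * (Q + 1 - 2 * N) / N :=
    div_nonneg (mul_nonneg (sub_nonneg.mpr hpow) (sub_nonneg.mpr hNQ)) hN0.le
  rw [← sub_nonneg]
  convert hnonneg using 1
  field_simp
  ring
end

section
/- Let r_2 be an integer with m/2 ≤ r_2 < m. Then f(r_2) + f(0) ≥ f(m/2) + f(r_2 − m/2); equivalently, f(r_2) ≥ f(m/2) + f(r_2 − m/2). -/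
theorem stmt13 (q m N : ℕ) (hq : 2 ≤ q) (hmeven : Even m) (hm : 2 ≤ m)
    (hN : 2 < N) (hNle : 2 * N ≤ q ^ (m / 2) + 1)
    (hsemi : (q : ZMod N) ^ (m / 2) = -1)
    (r2 : ℕ) (hr2a : m / 2 ≤ r2) (hr2b : r2 < m) :
    ghwf q N m (m / 2) + ghwf q N m (r2 - m / 2) ≤ ghwf q N m r2 + ghwf q N m 0 := by
  obtain ⟨k, rfl⟩ := hmeven
  have hk : (k + k) / 2 = k := by omega
  rw [hk] at hNle hr2a ⊢
  obtain ⟨s, rfl⟩ := Nat.exists_eq_add_of_le hr2a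
  rw [Nat.add_sub_cancel_left]
  rcases Nat.eq_zero_or_pos s with rfl | hs
  · simp
  have hN0 : (0 : ℚ) < N := by exact_mod_cast (by omega : 0 < N)
  have hNq : 2 * (N : ℚ) ≤ (q : ℚ) ^ k + 1 := by exact_mod_cast hNle
  have hx : (1 : ℚ) ≤ (q : ℚ) ^ s := one_le_pow₀ (by exact_mod_cast (by omega : 1 ≤ q))
  have hmul := mul_nonneg (sub_nonneg.2 hx) (sub_nonneg.2 hNq)
  unfold ghwf
  rw [if_pos (by omega), if_pos (by omega), if_neg (by omega), if_pos (by omega), hk,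
    Nat.add_sub_cancel_left, ← add_div, pow_zero, sub_self, add_zero, le_div_iff₀ hN0, pow_add]
  linarith
end

section
/- Let H be an F_q-subspace of F_Q^t with dim_{F_q} H = r. Then Σ_{y ∈ H} Σ_{h=1}^{t} η^{(N)}_{y_h} = q^r · Σ_{h=1}^{t} |{ x ∈ H^⊥ : x_i = 0 for all i ≠ h, and −x_h ∈ C_0^{(N)} }|, where y = (y_1, …, y_t) and x = (x_1, …, x_t). -/
/-- The canonical additive character `ψ(x) = exp(2π√-1 · Tr_{F/F_p}(x)/p)` of a field `F`
of characteristic `p`, where the absolute trace is identified with an integer mod `p`. -/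
noncomputable def canChar (p : ℕ) (F : Type*) [Field F] [Algebra (ZMod p) F] (x : F) : ℂ :=
  Complex.exp (2 * Real.pi * Complex.I * ((Algebra.trace (ZMod p) F x).val : ℂ) / p)

/-- The Gauss period `η^(N)_a = ∑_{x ∈ C_0^{(N)}} ψ_Q(a x)`, where
`C_0^{(N)} = ⟨γ^N⟩` is the 0-th cyclotomy class of order `N`. -/
noncomputable def gaussPeriod (p : ℕ) (F : Type*) [Field F] [Fintype F]
    [Algebra (ZMod p) F] (γ : F) (N : ℕ) (a : F) : ℂ :=
  ∑ x ∈ (Set.toFinite {x : F | ∃ k : ℕ, x = (γ ^ N) ^ k}).toFinset, canChar p F (a * x)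

theorem canChar_eq_stdAddChar (p : ℕ) [NeZero p] (F : Type*) [Field F] [Algebra (ZMod p) F]
    (x : F) : canChar p F x = ZMod.stdAddChar (Algebra.trace (ZMod p) F x) := by
  rw [canChar]
  have h := ZMod.stdAddChar_coe (N := p) ((Algebra.trace (ZMod p) F x).val : ℤ)
  push_cast at h
  rw [ZMod.natCast_zmod_val] at h
  exact h.symm

/-- If the composite of a `K`-linear functional with the absolute trace of `K` vanishes, so does
the functional. -/
theorem LinearMap.eq_zero_of_trace_comp_eq_zero {p : ℕ} [Fact p.Prime] {K V : Type*} [Field K]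
    [Finite K] [Algebra (ZMod p) K] [AddCommGroup V] [Module K V] (f : V →ₗ[K] K)
    (h : ∀ v, Algebra.trace (ZMod p) K (f v) = 0) : f = 0 := by
  ext v
  by_contra hv
  have : FiniteDimensional (ZMod p) K := Module.Finite.of_finite
  obtain ⟨a, ha⟩ := Algebra.trace_surjective (ZMod p) K 1
  have := h ((a * (f v)⁻¹) • v)
  rw [map_smul, smul_eq_mul, mul_assoc, inv_mul_cancel₀ hv, mul_one, ha] at this
  exact one_ne_zero this

/-- Orthogonality of characters along a `K`-linear map into an extension field `F`. -/
theorem sum_canChar_linearMap (p : ℕ) [Fact p.Prime] (K F V : Type*) [Field K] [Finite K]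
    [Field F] [Finite F] [Algebra K F] [Algebra (ZMod p) F] [AddCommGroup V] [Module K V]
    [Fintype V] (f : V →ₗ[K] F) [Decidable (∀ v, Algebra.trace K F (f v) = 0)] :
    ∑ v, canChar p F (f v) =
      if ∀ v, Algebra.trace K F (f v) = 0 then (Fintype.card V : ℂ) else 0 := by
  have : CharP F p := charP_of_injective_algebraMap (algebraMap (ZMod p) F).injective p
  have : CharP K p := (algebraMap K F).charP (algebraMap K F).injective p
  let _ : Algebra (ZMod p) K := ZMod.algebra K p
  have : IsScalarTower (ZMod p) K F := IsScalarTower.of_algebraMap_eq' (Subsingleton.elim _ _)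
  have : FiniteDimensional K F := Module.Finite.of_finite
  have : FiniteDimensional (ZMod p) K := Module.Finite.of_finite
  have key (v : V) : canChar p F (f v) =
      ZMod.stdAddChar (Algebra.trace (ZMod p) K (Algebra.trace K F (f v))) := by
    rw [canChar_eq_stdAddChar, Algebra.trace_trace]
  let χ : AddChar V ℂ := ZMod.stdAddChar.compAddMonoidHom
    ((Algebra.trace (ZMod p) K).toAddMonoidHom.comp (Algebra.trace K F ∘ₗ f).toAddMonoidHom)
  have hχ (v : V) : canChar p F (f v) = χ v := key v
  split_ifs with h
  · simp [key, h]
  · simp_rw [hχ]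
    refine AddChar.sum_eq_zero_of_ne_one fun h1 => h fun v => ?_
    have := LinearMap.eq_zero_of_trace_comp_eq_zero (p := p) (Algebra.trace K F ∘ₗ f) fun v => by
      apply ZMod.injective_stdAddChar
      rw [AddChar.map_zero_eq_one]
      exact DFunLike.congr_fun h1 v
    exact LinearMap.congr_fun this v

theorem stmt15 (p s m t : ℕ) (hp : p.Prime) (hs : 0 < s) (hm : 0 < m) (ht : 1 ≤ t)
    (q Q : ℕ) (hq : q = p ^ s) (hQ : Q = q ^ m)
    (K F : Type) [Field K] [Fintype K] [Field F] [Fintype F] [Algebra K F]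
    [Algebra (ZMod p) F]
    (hK : Fintype.card K = q) (hF : Fintype.card F = Q)
    (γ : F) (hγ : ∀ x : F, x ≠ 0 → ∃ k : ℕ, x = γ ^ k)
    (N : ℕ) (hN0 : 0 < N) (hNdvd : N ∣ Q - 1)
    (r : ℕ) (H : Submodule K (Fin t → F)) (hH : Module.finrank K H = r) :
    ∑ y ∈ (Set.toFinite (H : Set (Fin t → F))).toFinset,
        ∑ h : Fin t, gaussPeriod p F γ N (y h) =
      (q : ℂ) ^ r * ∑ h : Fin t,
        (Set.ncard {x : Fin t → F |
          (∀ y ∈ H, Algebra.trace K F (∑ i, x i * y i) = 0) ∧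
          (∀ i, i ≠ h → x i = 0) ∧ ∃ k : ℕ, -(x h) = (γ ^ N) ^ k} : ℂ) := by
  classical
  have : Fact p.Prime := ⟨hp⟩
  have hcard : (Fintype.card H : ℂ) = (q : ℂ) ^ r := by
    rw [Module.card_eq_pow_finrank (K := K) (V := H), hK, hH, Nat.cast_pow]
  rw [Finset.sum_comm, Finset.mul_sum]
  refine Finset.sum_congr rfl fun h _ => ?_
  set C := (Set.toFinite {x : F | ∃ k : ℕ, x = (γ ^ N) ^ k}).toFinset with hC
  have horth (c : F) : ∑ y ∈ (Set.toFinite (H : Set (Fin t → F))).toFinset, canChar p F (y h * c) =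
      if ∀ y ∈ H, Algebra.trace K F (c * y h) = 0 then (q : ℂ) ^ r else 0 := by
    rw [Finset.sum_subtype (p := (· ∈ H)) _ (by simp)]
    have := sum_canChar_linearMap p K F H
      (LinearMap.mulLeft K c ∘ₗ LinearMap.proj h ∘ₗ H.subtype)
    simpa [hcard, mul_comm] using this
  have hset : {x : Fin t → F | (∀ y ∈ H, Algebra.trace K F (∑ i, x i * y i) = 0) ∧
      (∀ i, i ≠ h → x i = 0) ∧ ∃ k : ℕ, -(x h) = (γ ^ N) ^ k} =
      (fun c => Pi.single h (-c)) ''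
        (C.filter fun c => ∀ y ∈ H, Algebra.trace K F (c * y h) = 0 : Finset F) := by
    ext x
    simp only [Set.mem_ofPred_eq, Set.mem_image, Finset.coe_filter, hC, Set.Finite.mem_toFinset]
    constructor
    · rintro ⟨h1, h2, h3⟩
      have hx : Pi.single h (x h) = x := by
        ext i
        by_cases hi : i = h
        · subst hi; simp
        · simp [hi, h2 i hi]
      refine ⟨-x h, ⟨h3, fun y hy => ?_⟩, by simpa using hx⟩
      have := h1 y hy
      rw [Finset.sum_eq_single h (fun i _ hi => by simp [h2 i hi]) (by simp)] at this
      simp [this]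
    · rintro ⟨c, ⟨hc, hc'⟩, rfl⟩
      refine ⟨fun y hy => ?_, fun i hi => by simp [hi], by simpa using hc⟩
      rw [Finset.sum_eq_single h (fun i _ hi => by simp [hi]) (by simp)]
      simp [hc' y hy]
  have hinj : Function.Injective fun c : F => (Pi.single h (-c) : Fin t → F) :=
    (Pi.single_injective h).comp neg_injective
  rw [hset, Set.ncard_image_of_injective _ hinj, Set.ncard_coe_finset]
  simp only [gaussPeriod]
  rw [Finset.sum_comm]
  simp_rw [horth]
  rw [← Finset.sum_filter, Finset.sum_const, nsmul_eq_mul, mul_comm]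
end
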